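/- Let (X,B) be a marked space and let U be a family of subsets of X whose interiors cover X. Then the inclusion of the complex of U-small admissible marked chains into the complex of all marked chains induces an isomorphism on homology in every degree. -/

import Mathlib

open scoped BigOperators
open Topology
noncomputable section

/-! ### Quasicones and marked spaces -/

/-- `B` is a *quasicone* with apex `b`: there is a homotopy `H` from the identity to the
constant map at `b` with `H ⁻¹' {b} = ({b} × I) ∪ (B × {1})`. -/
def IsQuasicone {B : Type*} [TopologicalSpace B] (b : B) : Prop :=
  ∃ H : C(B × unitInterval, B),
    (∀ x, H (x, 0) = x) ∧ (∀ x, H (x, 1) = b) ∧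
    (∀ x t, H (x, t) = b ↔ x = b ∨ t = 1)

/-- A *marked space* `(X, B)`: `B` is closed in `X` and every `b ∈ B` has a closed
quasiconical neighbourhood `F b` with apex `b`, the `F b` being pairwise disjoint. -/
structure IsMarkedSpace (X : Type*) [TopologicalSpace X] (B : Set X) : Prop where
  closed : IsClosed B
  quasicones : ∃ F : B → Set X,
    (∀ b : B, IsClosed (F b)) ∧ (∀ b : B, F b ∈ nhds (b : X)) ∧
    (∀ b b' : B, b ≠ b' → Disjoint (F b) (F b')) ∧
    (∀ b : B, ∃ hb : (b : X) ∈ F b, IsQuasicone (⟨(b : X), hb⟩ : F b))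

/-! ### Singular chains -/

/-- The topological standard `n`-simplex. -/
abbrev TopSimplex (n : ℕ) : Type := ↥(stdSimplex ℝ (Fin (n + 1)))

/-- Singular `n`-simplices in `X`. -/
abbrev SingularSimplex (X : Type*) [TopologicalSpace X] (n : ℕ) := C(TopSimplex n, X)

/-- Singular `n`-chains in `X` with coefficients in `R`. -/
abbrev SingularChain (R : Type*) [Ring R] (X : Type*) [TopologicalSpace X] (n : ℕ) :=
  SingularSimplex X n →₀ R

/-- The `i`-th coface map, on barycentric coordinates. -/
def cofaceFun {n : ℕ} (i : Fin (n + 2)) (x : Fin (n + 1) → ℝ) : Fin (n + 2) → ℝ :=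
  fun j => ∑ k : Fin (n + 1), if i.succAbove k = j then x k else 0

lemma cofaceFun_mem {n : ℕ} (i : Fin (n + 2)) {x : Fin (n + 1) → ℝ}
    (hx : x ∈ stdSimplex ℝ (Fin (n + 1))) : cofaceFun i x ∈ stdSimplex ℝ (Fin (n + 2)) := by
  constructor
  · intro j
    refine Finset.sum_nonneg fun k _ => ?_
    split_ifs
    · exact hx.1 k
    · exact le_rfl
  · unfold cofaceFun
    rw [Finset.sum_comm]
    simp only [Finset.sum_ite_eq, Finset.mem_univ, if_true]
    exact hx.2

/-- The `i`-th face inclusion `Δⁿ → Δⁿ⁺¹`. -/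
def coface {n : ℕ} (i : Fin (n + 2)) : C(TopSimplex n, TopSimplex (n + 1)) where
  toFun x := ⟨cofaceFun i (x : Fin (n + 1) → ℝ), cofaceFun_mem i x.2⟩
  continuous_toFun := by
    refine Continuous.subtype_mk ?_ _
    refine continuous_pi fun j => ?_
    unfold cofaceFun
    refine continuous_finset_sum _ fun k _ => ?_
    by_cases h : i.succAbove k = j
    · simp only [if_pos h]
      exact (continuous_apply k).comp continuous_subtype_val
    · simp only [if_neg h]
      exact continuous_const

/-- The boundary of a single `(n+1)`-simplex. -/
def boundaryOf (R : Type*) [Ring R] {X : Type*} [TopologicalSpace X] {n : ℕ}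
    (σ : SingularSimplex X (n + 1)) : SingularChain R X n :=
  ∑ i : Fin (n + 2), Finsupp.single (σ.comp (coface i)) ((-1 : R) ^ (i : ℕ))

/-- The singular boundary operator. -/
def boundary (R : Type*) [Ring R] (X : Type*) [TopologicalSpace X] (n : ℕ) :
    SingularChain R X (n + 1) →ₗ[R] SingularChain R X n :=
  Finsupp.lsum ℕ fun σ => LinearMap.toSpanSingleton R _ (boundaryOf R σ)

/-- Push-forward of chains along a continuous map. -/
def pushChain (R : Type*) [Ring R] {X Y : Type*} [TopologicalSpace X] [TopologicalSpace Y]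
    (f : C(X, Y)) (n : ℕ) : SingularChain R X n →ₗ[R] SingularChain R Y n :=
  Finsupp.lmapDomain R R fun σ : SingularSimplex X n => f.comp σ

/-- The face of `Δⁿ` spanned by the vertices in `S`. -/
def faceSet (n : ℕ) (S : Finset (Fin (n + 1))) : Set (TopSimplex n) :=
  {x | ∀ j ∉ S, (x : Fin (n + 1) → ℝ) j = 0}

/-- A subset of `Δⁿ` which is a union of (not necessarily proper) faces. -/
def IsSimplicialSubcomplex {n : ℕ} (A : Set (TopSimplex n)) : Prop :=
  ∃ 𝒮 : Set (Finset (Fin (n + 1))), A = ⋃ S ∈ 𝒮, faceSet n S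

/-- A singular simplex is *admissible* if the preimage of `B` is a union of faces. -/
def Admissible {X : Type*} [TopologicalSpace X] (B : Set X) {n : ℕ}
    (σ : SingularSimplex X n) : Prop :=
  IsSimplicialSubcomplex (σ ⁻¹' B)

/-- The submodule generated by admissible simplices. -/
def admissibleChains (R : Type*) [Ring R] (X : Type*) [TopologicalSpace X] (B : Set X)
    (n : ℕ) : Submodule R (SingularChain R X n) :=
  Submodule.span R {c | ∃ σ : SingularSimplex X n, Admissible B σ ∧ c = Finsupp.single σ 1}

/-- The submodule generated by simplices supported in `B`. -/
def chainsIn (R : Type*) [Ring R] (X : Type*) [TopologicalSpace X] (B : Set X)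
    (n : ℕ) : Submodule R (SingularChain R X n) :=
  Submodule.span R {c | ∃ σ : SingularSimplex X n, Set.range ⇑σ ⊆ B ∧ c = Finsupp.single σ 1}

/-- Cycles of the marked chain complex `C^M_*(X,B;R) = Ĉ^M_*(X,B;R)/C_*(B;R)`:
admissible chains whose boundary is supported in `B`. -/
def markedCycles (R : Type*) [Ring R] (X : Type*) [TopologicalSpace X] (B : Set X) :
    (n : ℕ) → Submodule R (SingularChain R X n)
  | 0 => admissibleChains R X B 0
  | (n + 1) => admissibleChains R X B (n + 1) ⊓
      Submodule.comap (boundary R X n) (chainsIn R X B n)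

/-- Boundaries of the marked chain complex. -/
def markedBoundaries (R : Type*) [Ring R] (X : Type*) [TopologicalSpace X] (B : Set X)
    (n : ℕ) : Submodule R (SingularChain R X n) :=
  Submodule.map (boundary R X n) (admissibleChains R X B (n + 1)) ⊔ chainsIn R X B n

/-- Relative cycles of the pair `(X, B)`. -/
def relativeCycles (R : Type*) [Ring R] (X : Type*) [TopologicalSpace X] (B : Set X) :
    (n : ℕ) → Submodule R (SingularChain R X n)
  | 0 => ⊤
  | (n + 1) => Submodule.comap (boundary R X n) (chainsIn R X B n)

/-- Relative boundaries of the pair `(X, B)`. -/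
def relativeBoundaries (R : Type*) [Ring R] (X : Type*) [TopologicalSpace X] (B : Set X)
    (n : ℕ) : Submodule R (SingularChain R X n) :=
  Submodule.map (boundary R X n) ⊤ ⊔ chainsIn R X B n

/-- The ℓ¹-norm of a real singular chain. -/
def l1Norm {X : Type*} [TopologicalSpace X] {n : ℕ} (c : SingularChain ℝ X n) : ℝ :=
  c.sum fun _ r => |r|

/-- The submodule generated by `𝒰`-small admissible simplices. -/
def smallAdmissibleChains (R : Type*) [Ring R] (X : Type*) [TopologicalSpace X]
    (B : Set X) (𝒰 : Set (Set X)) (n : ℕ) : Submodule R (SingularChain R X n) :=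
  Submodule.span R {c | ∃ σ : SingularSimplex X n, Admissible B σ ∧
    (∃ U ∈ 𝒰, Set.range ⇑σ ⊆ U) ∧ c = Finsupp.single σ 1}

/-- The submodule generated by `𝒰`-small simplices supported in `B`. -/
def smallChainsIn (R : Type*) [Ring R] (X : Type*) [TopologicalSpace X]
    (B : Set X) (𝒰 : Set (Set X)) (n : ℕ) : Submodule R (SingularChain R X n) :=
  Submodule.span R {c | ∃ σ : SingularSimplex X n, Set.range ⇑σ ⊆ B ∧
    (∃ U ∈ 𝒰, Set.range ⇑σ ⊆ U) ∧ c = Finsupp.single σ 1}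

/-- Cycles of the `𝒰`-small marked chain complex `C^{𝒰,M}_*(X,B;R)`. -/
def smallMarkedCycles (R : Type*) [Ring R] (X : Type*) [TopologicalSpace X]
    (B : Set X) (𝒰 : Set (Set X)) : (n : ℕ) → Submodule R (SingularChain R X n)
  | 0 => smallAdmissibleChains R X B 𝒰 0
  | (n + 1) => smallAdmissibleChains R X B 𝒰 (n + 1) ⊓
      Submodule.comap (boundary R X n) (chainsIn R X B n)

/-- Boundaries of the `𝒰`-small marked chain complex. -/
def smallMarkedBoundaries (R : Type*) [Ring R] (X : Type*) [TopologicalSpace X]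
    (B : Set X) (𝒰 : Set (Set X)) (n : ℕ) : Submodule R (SingularChain R X n) :=
  Submodule.map (boundary R X n) (smallAdmissibleChains R X B 𝒰 (n + 1)) ⊔
    smallChainsIn R X B 𝒰 n

/-! ### Chains on tuples -/

section TupleChains

variable (R : Type*) [Ring R] {V W : Type*}

lemma Finsupp.linearMap_ext_one {R α M : Type*} [Ring R] [AddCommGroup M] [Module R M]
    {f g : (α →₀ R) →ₗ[R] M}
    (h : ∀ a, f (Finsupp.single a 1) = g (Finsupp.single a 1)) : f = g :=
  Finsupp.lhom_ext' fun a => LinearMap.ext_ring (h a)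

lemma Finsupp.map_mem_of_mem_supported {R α M : Type*} [Ring R] [AddCommGroup M] [Module R M]
    (f : (α →₀ R) →ₗ[R] M) {s : Set α} {N : Submodule R M}
    (h : ∀ a ∈ s, f (Finsupp.single a 1) ∈ N) {c : α →₀ R}
    (hc : c ∈ Finsupp.supported R R s) : f c ∈ N := by
  rw [Finsupp.supported_eq_span_single] at hc
  have : Submodule.span R ((fun i => Finsupp.single i (1 : R)) '' s) ≤ N.comap f := by
    rw [Submodule.span_le]
    rintro _ ⟨a, ha, rfl⟩
    exact h a ha
  exact this hc

/-- Formal combinations of `m`-tuples in `V`: the augmented ordered chain complex of the full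
simplex on `V`, with `m`-tuples in dimension `m - 1`. -/
abbrev TupleChain (V : Type*) (m : ℕ) := (Fin m → V) →₀ R

/-- The alternating sum of the faces of a tuple. -/
def tupleBoundary (V : Type*) (m : ℕ) : TupleChain R V (m + 1) →ₗ[R] TupleChain R V m :=
  Finsupp.linearCombination R fun w =>
    ∑ i : Fin (m + 1), Finsupp.single (w ∘ i.succAbove) ((-1 : R) ^ (i : ℕ))

/-- The cone with apex `b`. -/
def tupleCone (b : V) (m : ℕ) : TupleChain R V m →ₗ[R] TupleChain R V (m + 1) :=
  Finsupp.lmapDomain R R fun w => Fin.cons b w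

/-- Push-forward of tuples along a map. -/
def tupleMap (f : V → W) (m : ℕ) : TupleChain R V m →ₗ[R] TupleChain R W m :=
  Finsupp.lmapDomain R R fun w => f ∘ w

@[simp] lemma tupleBoundary_single {m : ℕ} (w : Fin (m + 1) → V) :
    tupleBoundary R V m (Finsupp.single w 1) =
      ∑ i : Fin (m + 1), Finsupp.single (w ∘ i.succAbove) ((-1 : R) ^ (i : ℕ)) := by
  simp [tupleBoundary]

@[simp] lemma tupleCone_single (b : V) {m : ℕ} (w : Fin m → V) (r : R) :
    tupleCone R b m (Finsupp.single w r) = Finsupp.single (Fin.cons b w) r := by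
  simp [tupleCone]

@[simp] lemma tupleMap_single (f : V → W) {m : ℕ} (w : Fin m → V) (r : R) :
    tupleMap R f m (Finsupp.single w r) = Finsupp.single (f ∘ w) r := by
  simp [tupleMap]

lemma tupleBoundary_cone_zero (b : V) (c : TupleChain R V 0) :
    tupleBoundary R V 0 (tupleCone R b 0 c) = c := by
  suffices h : tupleBoundary R V 0 ∘ₗ tupleCone R b 0 = LinearMap.id from
    LinearMap.congr_fun h c
  refine Finsupp.linearMap_ext_one fun w => ?_
  simp only [LinearMap.comp_apply, tupleCone_single, tupleBoundary_single, LinearMap.id_apply,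
    Fin.sum_univ_succ, Finset.univ_eq_empty, Finset.sum_empty, add_zero, Fin.val_zero, pow_zero]
  congr 1

lemma tupleBoundary_cone_succ (b : V) {m : ℕ} (c : TupleChain R V (m + 1)) :
    tupleBoundary R V (m + 1) (tupleCone R b (m + 1) c) =
      c - tupleCone R b m (tupleBoundary R V m c) := by
  suffices h : tupleBoundary R V (m + 1) ∘ₗ tupleCone R b (m + 1) =
      LinearMap.id - tupleCone R b m ∘ₗ tupleBoundary R V m from LinearMap.congr_fun h c
  refine Finsupp.linearMap_ext_one fun w => ?_
  simp only [LinearMap.comp_apply, tupleCone_single, tupleBoundary_single, LinearMap.sub_apply,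
    LinearMap.id_apply, map_sum]
  rw [Fin.sum_univ_succ, sub_eq_add_neg, ← Finset.sum_neg_distrib]
  refine congrArg₂ (· + ·) ?_ (Finset.sum_congr rfl fun i _ => ?_)
  · rw [Fin.val_zero, pow_zero]
    congr 1
  rw [Fin.cons_comp_succ_succAbove, ← Finsupp.single_neg, Fin.val_succ, pow_succ]
  simp only [mul_neg, mul_one]
  rfl

lemma single_eq_tupleCone {m : ℕ} (w : Fin (m + 1) → V) (r : R) :
    (Finsupp.single w r : TupleChain R V (m + 1)) =
      tupleCone R (w 0) m (Finsupp.single (Fin.tail w) r) := by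
  rw [tupleCone_single, Fin.cons_self_tail]

lemma tupleBoundary_boundary {m : ℕ} (c : TupleChain R V (m + 2)) :
    tupleBoundary R V m (tupleBoundary R V (m + 1) c) = 0 := by
  suffices h : tupleBoundary R V m ∘ₗ tupleBoundary R V (m + 1) = 0 from
    LinearMap.congr_fun h c
  clear c
  induction m with
  | zero =>
    refine Finsupp.linearMap_ext_one fun w => ?_
    rw [single_eq_tupleCone, LinearMap.comp_apply, tupleBoundary_cone_succ, map_sub,
      tupleBoundary_cone_zero, sub_self, LinearMap.zero_apply]
  | succ m ih =>
    refine Finsupp.linearMap_ext_one fun w => ?_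
    have h := LinearMap.congr_fun ih (Finsupp.single (Fin.tail w) 1)
    simp only [LinearMap.comp_apply, LinearMap.zero_apply] at h
    rw [single_eq_tupleCone, LinearMap.comp_apply, tupleBoundary_cone_succ, map_sub,
      tupleBoundary_cone_succ, h, map_zero, sub_zero, sub_self, LinearMap.zero_apply]

lemma tupleMap_boundary (f : V → W) {m : ℕ} (c : TupleChain R V (m + 1)) :
    tupleMap R f m (tupleBoundary R V m c) = tupleBoundary R W m (tupleMap R f (m + 1) c) := by
  suffices h : tupleMap R f m ∘ₗ tupleBoundary R V m =
      tupleBoundary R W m ∘ₗ tupleMap R f (m + 1) from LinearMap.congr_fun h c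
  refine Finsupp.linearMap_ext_one fun w => ?_
  simp only [LinearMap.comp_apply, tupleBoundary_single, tupleMap_single, map_sum,
    Function.comp_assoc]

lemma tupleMap_cone (f : V → W) (b : V) {m : ℕ} (c : TupleChain R V m) :
    tupleMap R f (m + 1) (tupleCone R b m c) = tupleCone R (f b) m (tupleMap R f m c) := by
  suffices h : tupleMap R f (m + 1) ∘ₗ tupleCone R b m =
      tupleCone R (f b) m ∘ₗ tupleMap R f m from LinearMap.congr_fun h c
  refine Finsupp.linearMap_ext_one fun w => ?_
  simp only [LinearMap.comp_apply, tupleCone_single, tupleMap_single, Fin.comp_cons]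

/-- Barycentric subdivision of tuples with respect to a choice `bar` of barycentres. -/
def tupleSd (bar : ∀ m, (Fin (m + 1) → V) → V) :
    (m : ℕ) → TupleChain R V m →ₗ[R] TupleChain R V m
  | 0 => LinearMap.id
  | m + 1 => Finsupp.linearCombination R fun w =>
      tupleCone R (bar m w) m (tupleSd bar m (tupleBoundary R V m (Finsupp.single w 1)))

/-- The chain homotopy between the identity and barycentric subdivision. -/
def tupleHomotopy (bar : ∀ m, (Fin (m + 1) → V) → V) :
    (m : ℕ) → TupleChain R V m →ₗ[R] TupleChain R V (m + 1)
  | 0 => 0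
  | m + 1 => Finsupp.linearCombination R fun w =>
      tupleCone R (bar m w) (m + 1) (Finsupp.single w 1 -
        tupleHomotopy bar m (tupleBoundary R V m (Finsupp.single w 1)))

variable (bar : ∀ m, (Fin (m + 1) → V) → V)

lemma tupleSd_succ_single {m : ℕ} (w : Fin (m + 1) → V) :
    tupleSd R bar (m + 1) (Finsupp.single w 1) =
      tupleCone R (bar m w) m (tupleSd R bar m (tupleBoundary R V m (Finsupp.single w 1))) := by
  rw [tupleSd, Finsupp.linearCombination_single, one_smul]

lemma tupleHomotopy_succ_single {m : ℕ} (w : Fin (m + 1) → V) :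
    tupleHomotopy R bar (m + 1) (Finsupp.single w 1) =
      tupleCone R (bar m w) (m + 1) (Finsupp.single w 1 -
        tupleHomotopy R bar m (tupleBoundary R V m (Finsupp.single w 1))) := by
  rw [tupleHomotopy, Finsupp.linearCombination_single, one_smul]

lemma tupleBoundary_sd {m : ℕ} (c : TupleChain R V (m + 1)) :
    tupleBoundary R V m (tupleSd R bar (m + 1) c) =
      tupleSd R bar m (tupleBoundary R V m c) := by
  induction m with
  | zero =>
    suffices h : tupleBoundary R V 0 ∘ₗ tupleSd R bar 1 =
        tupleSd R bar 0 ∘ₗ tupleBoundary R V 0 from LinearMap.congr_fun h c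
    refine Finsupp.linearMap_ext_one fun w => ?_
    rw [LinearMap.comp_apply, tupleSd_succ_single, tupleBoundary_cone_zero, LinearMap.comp_apply]
  | succ m ih =>
    suffices h : tupleBoundary R V (m + 1) ∘ₗ tupleSd R bar (m + 2) =
        tupleSd R bar (m + 1) ∘ₗ tupleBoundary R V (m + 1) from LinearMap.congr_fun h c
    refine Finsupp.linearMap_ext_one fun w => ?_
    rw [LinearMap.comp_apply, tupleSd_succ_single, tupleBoundary_cone_succ, ih,
      tupleBoundary_boundary, map_zero, map_zero, sub_zero, LinearMap.comp_apply]

lemma tupleBoundary_homotopy {m : ℕ} (c : TupleChain R V (m + 1)) :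
    tupleBoundary R V (m + 1) (tupleHomotopy R bar (m + 1) c) =
      c - tupleSd R bar (m + 1) c - tupleHomotopy R bar m (tupleBoundary R V m c) := by
  induction m with
  | zero =>
    suffices h : tupleBoundary R V 1 ∘ₗ tupleHomotopy R bar 1 =
        LinearMap.id - tupleSd R bar 1 - tupleHomotopy R bar 0 ∘ₗ tupleBoundary R V 0 from
      LinearMap.congr_fun h c
    refine Finsupp.linearMap_ext_one fun w => ?_
    rw [LinearMap.comp_apply, tupleHomotopy_succ_single, tupleBoundary_cone_succ,
      LinearMap.sub_apply, LinearMap.sub_apply, LinearMap.comp_apply, tupleSd_succ_single]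
    simp only [tupleHomotopy, LinearMap.zero_apply, sub_zero, tupleSd, LinearMap.id_apply]
  | succ m ih =>
    suffices h : tupleBoundary R V (m + 2) ∘ₗ tupleHomotopy R bar (m + 2) =
        LinearMap.id - tupleSd R bar (m + 2) -
          tupleHomotopy R bar (m + 1) ∘ₗ tupleBoundary R V (m + 1) from
      LinearMap.congr_fun h c
    refine Finsupp.linearMap_ext_one fun w => ?_
    rw [LinearMap.comp_apply, tupleHomotopy_succ_single, tupleBoundary_cone_succ,
      LinearMap.sub_apply, LinearMap.sub_apply, LinearMap.comp_apply, tupleSd_succ_single,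
      map_sub (tupleBoundary R V (m + 1)), ih, tupleBoundary_boundary, map_zero, sub_zero,
      sub_sub_cancel, LinearMap.id_apply]
    abel

lemma tupleMap_sd {f : V → W} {bar' : ∀ m, (Fin (m + 1) → W) → W}
    (hf : ∀ m w, f (bar m w) = bar' m (f ∘ w)) {m : ℕ} (c : TupleChain R V m) :
    tupleMap R f m (tupleSd R bar m c) = tupleSd R bar' m (tupleMap R f m c) := by
  induction m with
  | zero => rfl
  | succ m ih =>
    suffices h : tupleMap R f (m + 1) ∘ₗ tupleSd R bar (m + 1) =
        tupleSd R bar' (m + 1) ∘ₗ tupleMap R f (m + 1) from LinearMap.congr_fun h c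
    refine Finsupp.linearMap_ext_one fun w => ?_
    rw [LinearMap.comp_apply, tupleSd_succ_single, tupleMap_cone, ih, tupleMap_boundary,
      LinearMap.comp_apply, tupleMap_single, tupleSd_succ_single, hf]

lemma tupleMap_homotopy {f : V → W} {bar' : ∀ m, (Fin (m + 1) → W) → W}
    (hf : ∀ m w, f (bar m w) = bar' m (f ∘ w)) {m : ℕ} (c : TupleChain R V m) :
    tupleMap R f (m + 1) (tupleHomotopy R bar m c) =
      tupleHomotopy R bar' m (tupleMap R f m c) := by
  induction m with
  | zero => simp [tupleHomotopy]
  | succ m ih =>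
    suffices h : tupleMap R f (m + 2) ∘ₗ tupleHomotopy R bar (m + 1) =
        tupleHomotopy R bar' (m + 1) ∘ₗ tupleMap R f (m + 1) from LinearMap.congr_fun h c
    refine Finsupp.linearMap_ext_one fun w => ?_
    rw [LinearMap.comp_apply, tupleHomotopy_succ_single, tupleMap_cone, map_sub, ih,
      tupleMap_boundary, LinearMap.comp_apply, tupleMap_single, tupleHomotopy_succ_single, hf]

end TupleChains

/-! ### Affine simplices -/

section AffineSimplices

/-- The affine map `Δᵐ → Δⁿ` with prescribed vertices. -/
def affineSimplex {m n : ℕ} (p : Fin (m + 1) → TopSimplex n) :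
    C(TopSimplex m, TopSimplex n) where
  toFun t := ⟨∑ i, (t : Fin (m + 1) → ℝ) i • (p i : Fin (n + 1) → ℝ),
    (convex_stdSimplex ℝ (Fin (n + 1))).sum_mem (fun i _ => t.2.1 i) t.2.2 fun i _ => (p i).2⟩
  continuous_toFun := by
    refine Continuous.subtype_mk ?_ _
    exact continuous_finsetSum _ fun i _ =>
      ((continuous_apply i).comp continuous_subtype_val).smul continuous_const

lemma affineSimplex_coe {m n : ℕ} (p : Fin (m + 1) → TopSimplex n) (t : TopSimplex m) :
    (affineSimplex p t : Fin (n + 1) → ℝ) =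
      ∑ i, (t : Fin (m + 1) → ℝ) i • (p i : Fin (n + 1) → ℝ) := rfl

lemma affineSimplex_coe_apply {m n : ℕ} (p : Fin (m + 1) → TopSimplex n) (t : TopSimplex m)
    (j : Fin (n + 1)) : (affineSimplex p t : Fin (n + 1) → ℝ) j =
      ∑ i, (t : Fin (m + 1) → ℝ) i * (p i : Fin (n + 1) → ℝ) j := by
  simp [affineSimplex_coe]

lemma affineSimplex_apply_affineSimplex {k m n : ℕ} (p : Fin (m + 1) → TopSimplex n)
    (q : Fin (k + 1) → TopSimplex m) (t : TopSimplex k) :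
    affineSimplex p (affineSimplex q t) = affineSimplex (affineSimplex p ∘ q) t := by
  refine stdSimplex.ext (funext fun j => ?_)
  simp only [affineSimplex_coe_apply, Function.comp_apply, Finset.sum_mul, Finset.mul_sum]
  rw [Finset.sum_comm]
  simp only [mul_assoc]

lemma affineSimplex_comp_affineSimplex {k m n : ℕ} (p : Fin (m + 1) → TopSimplex n)
    (q : Fin (k + 1) → TopSimplex m) :
    (affineSimplex p).comp (affineSimplex q) = affineSimplex (affineSimplex p ∘ q) :=
  ContinuousMap.ext fun t => affineSimplex_apply_affineSimplex p q t

/-- The vertices of the standard simplex. -/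
def simplexVertex (n : ℕ) (i : Fin (n + 1)) : TopSimplex n :=
  ⟨Pi.single i 1, single_mem_stdSimplex ℝ i⟩

lemma affineSimplex_comp_simplexVertex {m n : ℕ} (p : Fin (m + 1) → TopSimplex n) :
    affineSimplex p ∘ simplexVertex m = p := by
  refine funext fun i => stdSimplex.ext (funext fun j => ?_)
  simp [affineSimplex_coe_apply, simplexVertex, Pi.single_apply]

lemma affineSimplex_simplexVertex (n : ℕ) :
    affineSimplex (simplexVertex n) = ContinuousMap.id _ := by
  refine ContinuousMap.ext fun t => stdSimplex.ext (funext fun j => ?_)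
  simp [affineSimplex_coe_apply, simplexVertex, Pi.single_apply]

lemma coface_eq_affineSimplex {n : ℕ} (i : Fin (n + 2)) :
    coface i = affineSimplex (simplexVertex (n + 1) ∘ i.succAbove) := by
  refine ContinuousMap.ext fun t => stdSimplex.ext (funext fun j => ?_)
  simp [affineSimplex_coe_apply, simplexVertex, Pi.single_apply, eq_comm (a := j)]
  rfl

lemma affineSimplex_comp_coface {m n : ℕ} (p : Fin (m + 2) → TopSimplex n) (i : Fin (m + 2)) :
    (affineSimplex p).comp (coface i) = affineSimplex (p ∘ i.succAbove) := by
  rw [coface_eq_affineSimplex, affineSimplex_comp_affineSimplex, ← Function.comp_assoc,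
    affineSimplex_comp_simplexVertex]

lemma preimage_affineSimplex_faceSet {m n : ℕ} (p : Fin (m + 1) → TopSimplex n)
    (S : Finset (Fin (n + 1))) :
    ∃ S' : Finset (Fin (m + 1)), affineSimplex p ⁻¹' faceSet n S = faceSet m S' := by
  classical
  refine ⟨Finset.univ.filter fun i => p i ∈ faceSet n S, Set.ext fun t => ?_⟩
  have h (j : Fin (n + 1)) : (affineSimplex p t : Fin (n + 1) → ℝ) j = 0 ↔
      ∀ i, (t : Fin (m + 1) → ℝ) i = 0 ∨ (p i : Fin (n + 1) → ℝ) j = 0 := by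
    rw [affineSimplex_coe_apply, Finset.sum_eq_zero_iff_of_nonneg fun i _ =>
      mul_nonneg (stdSimplex.zero_le t i) (stdSimplex.zero_le (p i) j)]
    simp [mul_eq_zero]
  have hmem (i : Fin (m + 1)) : i ∉ Finset.univ.filter (fun i => p i ∈ faceSet n S) ↔
      ∃ j, j ∉ S ∧ (p i : Fin (n + 1) → ℝ) j ≠ 0 := by
    rw [Finset.mem_filter_univ]
    simp [faceSet]
  change (∀ j ∉ S, (affineSimplex p t : Fin (n + 1) → ℝ) j = 0) ↔
    ∀ i ∉ Finset.univ.filter (fun i => p i ∈ faceSet n S), (t : Fin (m + 1) → ℝ) i = 0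
  simp only [h, hmem]
  constructor
  · rintro H i ⟨j, hj, hij⟩
    exact (H j hj i).resolve_right hij
  · intro H j hj i
    by_cases hij : (p i : Fin (n + 1) → ℝ) j = 0
    · exact Or.inr hij
    · exact Or.inl (H i ⟨j, hj, hij⟩)

lemma Admissible.comp_affineSimplex {X : Type*} [TopologicalSpace X] {B : Set X} {m n : ℕ}
    {σ : SingularSimplex X n} (hσ : Admissible B σ) (p : Fin (m + 1) → TopSimplex n) :
    Admissible B (σ.comp (affineSimplex p)) := by
  obtain ⟨𝒮, h𝒮⟩ := hσ
  choose f hf using preimage_affineSimplex_faceSet p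
  refine ⟨f '' 𝒮, ?_⟩
  rw [ContinuousMap.coe_comp, Set.preimage_comp, h𝒮, Set.preimage_iUnion₂, Set.biUnion_image]
  simp only [hf]

/-- The barycentre of a tuple of points of a simplex. -/
def tupleBarycenter {n : ℕ} (m : ℕ) (w : Fin (m + 1) → TopSimplex n) : TopSimplex n :=
  affineSimplex w stdSimplex.barycenter

lemma affineSimplex_tupleBarycenter {m n : ℕ} (p : Fin (m + 1) → TopSimplex n) (k : ℕ)
    (w : Fin (k + 1) → TopSimplex m) :
    affineSimplex p (tupleBarycenter k w) = tupleBarycenter k (affineSimplex p ∘ w) :=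
  affineSimplex_apply_affineSimplex p w _

/-! ### Diameter estimates -/

lemma dist_affineSimplex_le_sum {m n : ℕ} (p : Fin (m + 1) → TopSimplex n) (t : TopSimplex m)
    (x : TopSimplex n) :
    dist (affineSimplex p t) x ≤ ∑ i, (t : Fin (m + 1) → ℝ) i * dist (p i) x := by
  have h : (affineSimplex p t : Fin (n + 1) → ℝ) - x =
      ∑ i, (t : Fin (m + 1) → ℝ) i • ((p i : Fin (n + 1) → ℝ) - x) := by
    simp only [smul_sub, Finset.sum_sub_distrib, ← Finset.sum_smul, affineSimplex_coe]
    rw [stdSimplex.sum_eq_one t, one_smul]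
  have hdist (y : TopSimplex n) :
      dist y x = ‖(y : Fin (n + 1) → ℝ) - (x : Fin (n + 1) → ℝ)‖ :=
    (Subtype.dist_eq y x).trans (dist_eq_norm _ _)
  simp only [hdist, h]
  refine (norm_sum_le _ _).trans (Finset.sum_le_sum fun i _ => ?_)
  rw [norm_smul, Real.norm_of_nonneg (stdSimplex.zero_le t i)]

lemma dist_affineSimplex_le {m n : ℕ} {p : Fin (m + 1) → TopSimplex n} {x : TopSimplex n}
    {r : ℝ} (h : ∀ i, dist (p i) x ≤ r) (t : TopSimplex m) :
    dist (affineSimplex p t) x ≤ r := by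
  calc _ ≤ ∑ i, (t : Fin (m + 1) → ℝ) i * dist (p i) x := dist_affineSimplex_le_sum p t x
    _ ≤ ∑ i, (t : Fin (m + 1) → ℝ) i * r :=
      Finset.sum_le_sum fun i _ => mul_le_mul_of_nonneg_left (h i) (t.2.1 i)
    _ = r := by rw [← Finset.sum_mul, stdSimplex.sum_eq_one t, one_mul]

lemma dist_tupleBarycenter_le {m n : ℕ} {w : Fin (m + 1) → TopSimplex n} {d : ℝ}
    (hw : ∀ i j, dist (w i) (w j) ≤ d) (k : Fin (m + 1)) :
    dist (w k) (tupleBarycenter m w) ≤ (m / (m + 1) : ℝ) * d := by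
  rw [dist_comm]
  refine (dist_affineSimplex_le_sum w _ _).trans ?_
  have hb (i : Fin (m + 1)) :
      ((stdSimplex.barycenter : TopSimplex m) : Fin (m + 1) → ℝ) i = ((m : ℝ) + 1)⁻¹ := by
    refine (stdSimplex.barycenter_apply (𝕜 := ℝ) i).trans ?_
    simp
  simp only [hb]
  rw [← Finset.mul_sum, Fin.sum_univ_succAbove _ k, dist_self, zero_add, div_mul_eq_mul_div,
    div_eq_inv_mul]
  gcongr
  calc _ ≤ ∑ _i : Fin m, d := Finset.sum_le_sum fun i _ => hw _ _
    _ = m * d := by simp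

/-- Tuples of mesh at most `r` which lie in every closed ball containing `w`. -/
def finerTuples {n m : ℕ} (w : Fin m → TopSimplex n) (r : ℝ) : Set (Fin m → TopSimplex n) :=
  {p | (∀ x ρ, (∀ k, dist (w k) x ≤ ρ) → ∀ i, dist (p i) x ≤ ρ) ∧
    ∀ i j, dist (p i) (p j) ≤ r}

variable (R : Type*) [Ring R]

lemma tupleSd_single_mem {n m : ℕ} {w : Fin m → TopSimplex n} {d : ℝ} (hd : 0 ≤ d)
    (hw : ∀ i j, dist (w i) (w j) ≤ d) :
    tupleSd R tupleBarycenter m (Finsupp.single w 1) ∈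
      Finsupp.supported R R (finerTuples w ((m / (m + 1) : ℝ) * d)) := by
  induction m with
  | zero => exact Finsupp.single_mem_supported R _ ⟨fun _ _ _ i => i.elim0, fun i => i.elim0⟩
  | succ m ih =>
    rw [tupleSd_succ_single, tupleBoundary_single, map_sum, map_sum]
    refine Submodule.sum_mem _ fun l _ => ?_
    rw [← mul_one ((-1 : R) ^ (l : ℕ)), ← smul_eq_mul (_ ^ _ : R), ← Finsupp.smul_single, map_smul,
      map_smul]
    refine Submodule.smul_mem _ _ ?_
    refine Finsupp.map_mem_of_mem_supported _ (fun q hq => ?_)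
      (ih (w := w ∘ l.succAbove) fun i j => hw _ _)
    rw [tupleCone_single]
    refine Finsupp.single_mem_supported R _ ?_
    obtain ⟨hball, hmesh⟩ := hq
    have hfac : (m / (m + 1) : ℝ) * d ≤ (((m + 1 : ℕ) : ℝ) / ((m + 1 : ℕ) + 1)) * d := by
      refine mul_le_mul_of_nonneg_right ?_ hd
      push_cast
      rw [div_le_div_iff₀ (by positivity) (by positivity)]
      nlinarith
    have hq (i : Fin m) : dist (q i) (tupleBarycenter m w) ≤ (m / (m + 1) : ℝ) * d :=
      hball _ _ (fun k => dist_tupleBarycenter_le hw _) i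
    have hpos : 0 ≤ (m / (m + 1) : ℝ) * d := by positivity
    refine ⟨fun x ρ h i => ?_, fun i j => le_trans ?_ hfac⟩
    · refine Fin.cases ?_ (fun i => ?_) i
      · exact dist_affineSimplex_le h _
      · exact hball x ρ (fun k => h _) i
    · refine Fin.cases (Fin.cases ?_ (fun j => ?_) j) (fun i => Fin.cases ?_ (fun j => ?_) j) i
      · simpa using hpos
      · simpa [dist_comm] using hq j
      · simpa using hq i
      · simpa using hmesh i j

lemma tupleSd_iterate_single_mem {n m : ℕ} {w : Fin m → TopSimplex n} {d : ℝ} (hd : 0 ≤ d)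
    (hw : ∀ i j, dist (w i) (w j) ≤ d) (N : ℕ) :
    (tupleSd R tupleBarycenter m ^ N) (Finsupp.single w 1) ∈
      Finsupp.supported R R {p : Fin m → TopSimplex n |
        ∀ i j, dist (p i) (p j) ≤ (m / (m + 1) : ℝ) ^ N * d} := by
  induction N with
  | zero => exact Finsupp.single_mem_supported R _ (by simpa using hw)
  | succ N ih =>
    rw [pow_succ' (tupleSd R _ m), Module.End.mul_apply]
    refine Finsupp.map_mem_of_mem_supported _ (fun p hp => ?_) ih
    refine Finsupp.supported_mono (fun q hq i j => ?_)
      (tupleSd_single_mem R (by positivity) hp)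
    rw [pow_succ', mul_assoc]
    exact hq.2 i j

end AffineSimplices

/-! ### Subdivision of singular chains -/

section SingularSubdivision

variable (R : Type*) [Ring R] {X : Type*} [TopologicalSpace X]

/-- The singular chain in `X` obtained from a chain of vertex tuples in `Δⁿ` and a singular
simplex `Δⁿ → X`. -/
def realizeTuples {n : ℕ} (σ : SingularSimplex X n) (m : ℕ) :
    TupleChain R (TopSimplex n) (m + 1) →ₗ[R] SingularChain R X m :=
  Finsupp.lmapDomain R R fun p => σ.comp (affineSimplex p)

@[simp] lemma realizeTuples_single {n m : ℕ} (σ : SingularSimplex X n)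
    (p : Fin (m + 1) → TopSimplex n) (r : R) :
    realizeTuples R σ m (Finsupp.single p r) = Finsupp.single (σ.comp (affineSimplex p)) r := by
  simp [realizeTuples]

lemma boundary_single {n : ℕ} (σ : SingularSimplex X (n + 1)) :
    boundary R X n (Finsupp.single σ 1) = boundaryOf R σ := by
  simp [boundary]

lemma boundary_realizeTuples {n m : ℕ} (σ : SingularSimplex X n)
    (c : TupleChain R (TopSimplex n) (m + 2)) :
    boundary R X m (realizeTuples R σ (m + 1) c) =
      realizeTuples R σ m (tupleBoundary R _ (m + 1) c) := by
  suffices h : boundary R X m ∘ₗ realizeTuples R σ (m + 1) =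
      realizeTuples R σ m ∘ₗ tupleBoundary R _ (m + 1) from LinearMap.congr_fun h c
  refine Finsupp.linearMap_ext_one fun p => ?_
  simp only [LinearMap.comp_apply, realizeTuples_single, boundary_single, boundaryOf,
    tupleBoundary_single, map_sum, ContinuousMap.comp_assoc, affineSimplex_comp_coface]

lemma realizeTuples_comp_affineSimplex {n k m : ℕ} (σ : SingularSimplex X n)
    (p : Fin (k + 1) → TopSimplex n) (c : TupleChain R (TopSimplex k) (m + 1)) :
    realizeTuples R (σ.comp (affineSimplex p)) m c =
      realizeTuples R σ m (tupleMap R (affineSimplex p) (m + 1) c) := by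
  suffices h : realizeTuples R (σ.comp (affineSimplex p)) m =
      realizeTuples R σ m ∘ₗ tupleMap R (affineSimplex p) (m + 1) from LinearMap.congr_fun h c
  refine Finsupp.linearMap_ext_one fun q => ?_
  simp only [LinearMap.comp_apply, realizeTuples_single, tupleMap_single,
    ContinuousMap.comp_assoc, affineSimplex_comp_affineSimplex]

variable (X)

/-- Barycentric subdivision of singular chains. -/
def singularSd (n : ℕ) : SingularChain R X n →ₗ[R] SingularChain R X n :=
  Finsupp.linearCombination R fun σ => realizeTuples R σ n
    (tupleSd R tupleBarycenter (n + 1) (Finsupp.single (simplexVertex n) 1))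

/-- The chain homotopy between the identity and barycentric subdivision of singular chains. -/
def singularHomotopy (n : ℕ) : SingularChain R X n →ₗ[R] SingularChain R X (n + 1) :=
  Finsupp.linearCombination R fun σ => realizeTuples R σ (n + 1)
    (tupleHomotopy R tupleBarycenter (n + 1) (Finsupp.single (simplexVertex n) 1))

variable {X}

lemma singularSd_single {n : ℕ} (σ : SingularSimplex X n) :
    singularSd R X n (Finsupp.single σ 1) = realizeTuples R σ n
      (tupleSd R tupleBarycenter (n + 1) (Finsupp.single (simplexVertex n) 1)) := by
  rw [singularSd, Finsupp.linearCombination_single, one_smul]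

lemma singularHomotopy_single {n : ℕ} (σ : SingularSimplex X n) :
    singularHomotopy R X n (Finsupp.single σ 1) = realizeTuples R σ (n + 1)
      (tupleHomotopy R tupleBarycenter (n + 1) (Finsupp.single (simplexVertex n) 1)) := by
  rw [singularHomotopy, Finsupp.linearCombination_single, one_smul]

lemma singularSd_realizeTuples {n m : ℕ} (σ : SingularSimplex X n)
    (c : TupleChain R (TopSimplex n) (m + 1)) :
    singularSd R X m (realizeTuples R σ m c) =
      realizeTuples R σ m (tupleSd R tupleBarycenter (m + 1) c) := by
  suffices h : singularSd R X m ∘ₗ realizeTuples R σ m =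
      realizeTuples R σ m ∘ₗ tupleSd R tupleBarycenter (m + 1) from LinearMap.congr_fun h c
  refine Finsupp.linearMap_ext_one fun p => ?_
  rw [LinearMap.comp_apply, realizeTuples_single, singularSd_single,
    realizeTuples_comp_affineSimplex,
    tupleMap_sd R _ (affineSimplex_tupleBarycenter p), tupleMap_single,
    affineSimplex_comp_simplexVertex, LinearMap.comp_apply]

lemma singularHomotopy_realizeTuples {n m : ℕ} (σ : SingularSimplex X n)
    (c : TupleChain R (TopSimplex n) (m + 1)) :
    singularHomotopy R X m (realizeTuples R σ m c) =
      realizeTuples R σ (m + 1) (tupleHomotopy R tupleBarycenter (m + 1) c) := by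
  suffices h : singularHomotopy R X m ∘ₗ realizeTuples R σ m =
      realizeTuples R σ (m + 1) ∘ₗ tupleHomotopy R tupleBarycenter (m + 1) from
    LinearMap.congr_fun h c
  refine Finsupp.linearMap_ext_one fun p => ?_
  rw [LinearMap.comp_apply, realizeTuples_single, singularHomotopy_single,
    realizeTuples_comp_affineSimplex,
    tupleMap_homotopy R _ (affineSimplex_tupleBarycenter p), tupleMap_single,
    affineSimplex_comp_simplexVertex, LinearMap.comp_apply]

lemma single_eq_realizeTuples {n : ℕ} (σ : SingularSimplex X n) :
    Finsupp.single σ (1 : R) =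
      realizeTuples R σ n (Finsupp.single (simplexVertex n) 1) := by
  rw [realizeTuples_single, affineSimplex_simplexVertex, ContinuousMap.comp_id]

lemma boundary_singularSd {n : ℕ} (c : SingularChain R X (n + 1)) :
    boundary R X n (singularSd R X (n + 1) c) = singularSd R X n (boundary R X n c) := by
  suffices h : boundary R X n ∘ₗ singularSd R X (n + 1) =
      singularSd R X n ∘ₗ boundary R X n from LinearMap.congr_fun h c
  refine Finsupp.linearMap_ext_one fun σ => ?_
  rw [single_eq_realizeTuples, LinearMap.comp_apply, LinearMap.comp_apply,
    singularSd_realizeTuples, boundary_realizeTuples, tupleBoundary_sd, boundary_realizeTuples,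
    singularSd_realizeTuples]

lemma boundary_singularHomotopy_zero (c : SingularChain R X 0) :
    boundary R X 0 (singularHomotopy R X 0 c) = c - singularSd R X 0 c := by
  suffices h : boundary R X 0 ∘ₗ singularHomotopy R X 0 =
      LinearMap.id - singularSd R X 0 from LinearMap.congr_fun h c
  refine Finsupp.linearMap_ext_one fun σ => ?_
  rw [single_eq_realizeTuples, LinearMap.comp_apply, LinearMap.sub_apply,
    singularHomotopy_realizeTuples, boundary_realizeTuples, tupleBoundary_homotopy,
    singularSd_realizeTuples]
  simp only [map_sub, tupleHomotopy, LinearMap.zero_apply, sub_zero, LinearMap.id_apply]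

lemma boundary_singularHomotopy_succ {n : ℕ} (c : SingularChain R X (n + 1)) :
    boundary R X (n + 1) (singularHomotopy R X (n + 1) c) =
      c - singularSd R X (n + 1) c - singularHomotopy R X n (boundary R X n c) := by
  suffices h : boundary R X (n + 1) ∘ₗ singularHomotopy R X (n + 1) =
      LinearMap.id - singularSd R X (n + 1) - singularHomotopy R X n ∘ₗ boundary R X n from
    LinearMap.congr_fun h c
  refine Finsupp.linearMap_ext_one fun σ => ?_
  rw [single_eq_realizeTuples, LinearMap.comp_apply, LinearMap.sub_apply, LinearMap.sub_apply,
    singularHomotopy_realizeTuples, boundary_realizeTuples, tupleBoundary_homotopy,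
    singularSd_realizeTuples, LinearMap.comp_apply, boundary_realizeTuples,
    singularHomotopy_realizeTuples]
  simp only [map_sub, LinearMap.id_apply]

lemma boundary_singularSd_pow {n : ℕ} (N : ℕ) (c : SingularChain R X (n + 1)) :
    boundary R X n ((singularSd R X (n + 1) ^ N) c) =
      (singularSd R X n ^ N) (boundary R X n c) := by
  induction N with
  | zero => rfl
  | succ N ih =>
    rw [pow_succ', pow_succ', Module.End.mul_apply, Module.End.mul_apply, boundary_singularSd, ih]

/-- The chain homotopy between the identity and `N`-fold barycentric subdivision. -/
def iteratedHomotopy (R : Type*) [Ring R] (X : Type*) [TopologicalSpace X] (N n : ℕ) :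
    SingularChain R X n →ₗ[R] SingularChain R X (n + 1) :=
  ∑ k ∈ Finset.range N, singularHomotopy R X n ∘ₗ singularSd R X n ^ k

lemma iteratedHomotopy_apply (N n : ℕ) (c : SingularChain R X n) :
    iteratedHomotopy R X N n c =
      ∑ k ∈ Finset.range N, singularHomotopy R X n ((singularSd R X n ^ k) c) := by
  simp [iteratedHomotopy]

lemma boundary_iteratedHomotopy_zero (N : ℕ) (c : SingularChain R X 0) :
    boundary R X 0 (iteratedHomotopy R X N 0 c) = c - (singularSd R X 0 ^ N) c := by
  rw [iteratedHomotopy_apply, map_sum]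
  simp only [boundary_singularHomotopy_zero, ← Module.End.mul_apply, ← pow_succ']
  rw [Finset.sum_range_sub', pow_zero, Module.End.one_apply]

lemma boundary_iteratedHomotopy_succ (N : ℕ) {n : ℕ} (c : SingularChain R X (n + 1)) :
    boundary R X (n + 1) (iteratedHomotopy R X N (n + 1) c) =
      c - (singularSd R X (n + 1) ^ N) c - iteratedHomotopy R X N n (boundary R X n c) := by
  rw [iteratedHomotopy_apply, iteratedHomotopy_apply, map_sum]
  simp only [boundary_singularHomotopy_succ, boundary_singularSd_pow]
  rw [Finset.sum_sub_distrib]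
  simp only [← Module.End.mul_apply, ← pow_succ']
  rw [Finset.sum_range_sub', pow_zero, Module.End.one_apply]

/-- A family of sets of singular simplices stable under precomposition with affine maps between
standard simplices. -/
def IsAffineStable (Q : ∀ n, Set (SingularSimplex X n)) : Prop :=
  ∀ ⦃m n : ℕ⦄ (σ : SingularSimplex X n), σ ∈ Q n → ∀ p : Fin (m + 1) → TopSimplex n,
    σ.comp (affineSimplex p) ∈ Q m

variable {R} {Q : ∀ n, Set (SingularSimplex X n)}

lemma IsAffineStable.realizeTuples_mem (hQ : IsAffineStable Q) {n m : ℕ}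
    {σ : SingularSimplex X n} (hσ : σ ∈ Q n) (c : TupleChain R (TopSimplex n) (m + 1)) :
    realizeTuples R σ m c ∈ Finsupp.supported R R (Q m) := by
  refine Finsupp.map_mem_of_mem_supported (s := Set.univ) _ (fun p _ => ?_) (by simp)
  rw [realizeTuples_single]
  exact Finsupp.single_mem_supported R _ (hQ σ hσ p)

lemma IsAffineStable.boundary_mem (hQ : IsAffineStable Q) {n : ℕ}
    {c : SingularChain R X (n + 1)} (hc : c ∈ Finsupp.supported R R (Q (n + 1))) :
    boundary R X n c ∈ Finsupp.supported R R (Q n) := by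
  refine Finsupp.map_mem_of_mem_supported _ (fun σ hσ => ?_) hc
  rw [single_eq_realizeTuples, boundary_realizeTuples]
  exact hQ.realizeTuples_mem hσ _

lemma IsAffineStable.singularSd_pow_mem (hQ : IsAffineStable Q) (N : ℕ) {n : ℕ}
    {c : SingularChain R X n} (hc : c ∈ Finsupp.supported R R (Q n)) :
    (singularSd R X n ^ N) c ∈ Finsupp.supported R R (Q n) := by
  induction N with
  | zero => exact hc
  | succ N ih =>
    rw [pow_succ', Module.End.mul_apply]
    refine Finsupp.map_mem_of_mem_supported _ (fun σ hσ => ?_) ih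
    rw [singularSd_single]
    exact hQ.realizeTuples_mem hσ _

lemma IsAffineStable.iteratedHomotopy_mem (hQ : IsAffineStable Q) (N : ℕ) {n : ℕ}
    {c : SingularChain R X n} (hc : c ∈ Finsupp.supported R R (Q n)) :
    iteratedHomotopy R X N n c ∈ Finsupp.supported R R (Q (n + 1)) := by
  rw [iteratedHomotopy_apply]
  refine Submodule.sum_mem _ fun k _ => ?_
  refine Finsupp.map_mem_of_mem_supported _ (fun σ hσ => ?_) (hQ.singularSd_pow_mem k hc)
  rw [singularHomotopy_single]
  exact hQ.realizeTuples_mem hσ _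

end SingularSubdivision

/-! ### Small simplices -/

section Small

variable {X : Type*} [TopologicalSpace X]

/-- The `𝒰`-small singular simplices. -/
def smallSimplices (𝒰 : Set (Set X)) (n : ℕ) : Set (SingularSimplex X n) :=
  {σ | ∃ U ∈ 𝒰, Set.range σ ⊆ U}

lemma isAffineStable_admissible (B : Set X) :
    IsAffineStable fun n => {σ : SingularSimplex X n | Admissible B σ} :=
  fun _ _ _ hσ p => Admissible.comp_affineSimplex hσ p

lemma isAffineStable_range_subset (B : Set X) :
    IsAffineStable fun n => {σ : SingularSimplex X n | Set.range σ ⊆ B} :=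
  fun _ _ σ hσ p => (Set.range_comp_subset_range (affineSimplex p) σ).trans hσ

lemma isAffineStable_smallSimplices (𝒰 : Set (Set X)) : IsAffineStable (smallSimplices 𝒰) :=
  fun _ _ σ ⟨U, hU, hσ⟩ p => ⟨U, hU, (Set.range_comp_subset_range (affineSimplex p) σ).trans hσ⟩

variable (R : Type*) [Ring R]

lemma singularSd_pow_single (N : ℕ) {n : ℕ} (σ : SingularSimplex X n) :
    (singularSd R X n ^ N) (Finsupp.single σ 1) = realizeTuples R σ n
      ((tupleSd R tupleBarycenter (n + 1) ^ N) (Finsupp.single (simplexVertex n) 1)) := by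
  induction N with
  | zero => exact single_eq_realizeTuples R σ
  | succ N ih =>
    rw [pow_succ', pow_succ', Module.End.mul_apply, ih, singularSd_realizeTuples,
      Module.End.mul_apply]

lemma exists_singularSd_pow_single_mem {𝒰 : Set (Set X)}
    (hcover : (⋃ U ∈ 𝒰, interior U) = Set.univ) {n : ℕ} (σ : SingularSimplex X n) :
    ∃ N, (singularSd R X n ^ N) (Finsupp.single σ 1) ∈
      Finsupp.supported R R (smallSimplices 𝒰 n) := by
  have : CompactSpace (TopSimplex n) :=
    isCompact_iff_compactSpace.1 (isCompact_stdSimplex ℝ (Fin (n + 1)))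
  obtain ⟨δ, hδ, hball⟩ := lebesgue_number_lemma_of_metric
    (c := fun U : 𝒰 => σ ⁻¹' interior (U : Set X)) (isCompact_univ (X := TopSimplex n))
    (fun U => isOpen_interior.preimage σ.continuous) (fun t _ => by
      have h : σ t ∈ ⋃ U ∈ 𝒰, interior U := hcover ▸ Set.mem_univ _
      simpa using h)
  set d := Metric.diam (Set.univ : Set (TopSimplex n)) with hd
  set κ : ℝ := ((n + 1 : ℕ) : ℝ) / ((n + 1 : ℕ) + 1) with hκ
  have hlim : Filter.Tendsto (fun N : ℕ => κ ^ N * d) Filter.atTop (𝓝 0) := by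
    have h := (tendsto_pow_atTop_nhds_zero_of_lt_one (r := κ) (by positivity)
      (by rw [hκ, div_lt_one (by positivity)]; linarith)).mul_const d
    rwa [zero_mul] at h
  obtain ⟨N, hN⟩ := (hlim.eventually (gt_mem_nhds hδ)).exists
  refine ⟨N, ?_⟩
  rw [singularSd_pow_single]
  refine Finsupp.map_mem_of_mem_supported _ (fun p hp => ?_)
    (tupleSd_iterate_single_mem R (d := d) Metric.diam_nonneg
      (fun i j => Metric.dist_le_diam_of_mem isCompact_univ.isBounded trivial trivial) N)
  rw [realizeTuples_single]
  refine Finsupp.single_mem_supported R _ ?_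
  obtain ⟨U, hU⟩ := hball (p 0) trivial
  refine ⟨U, U.2, ?_⟩
  rintro _ ⟨t, rfl⟩
  exact interior_subset (hU ((dist_affineSimplex_le (fun i => hp i 0) t).trans_lt hN))

lemma exists_singularSd_pow_mem {𝒰 : Set (Set X)}
    (hcover : (⋃ U ∈ 𝒰, interior U) = Set.univ) {n : ℕ} (c : SingularChain R X n) :
    ∃ N₀, ∀ N ≥ N₀, (singularSd R X n ^ N) c ∈ Finsupp.supported R R (smallSimplices 𝒰 n) := by
  induction c using Finsupp.induction_linear with
  | zero => exact ⟨0, fun N _ => by simp⟩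
  | add c c' hc hc' =>
    obtain ⟨N₀, h⟩ := hc
    obtain ⟨N₁, h'⟩ := hc'
    refine ⟨max N₀ N₁, fun N hN => ?_⟩
    rw [map_add]
    exact Submodule.add_mem _ (h N (le_of_max_le_left hN)) (h' N (le_of_max_le_right hN))
  | single σ r =>
    obtain ⟨N₀, h⟩ := exists_singularSd_pow_single_mem R hcover σ
    refine ⟨N₀, fun N hN => ?_⟩
    rw [← mul_one r, ← smul_eq_mul, ← Finsupp.smul_single, map_smul]
    refine Submodule.smul_mem _ _ ?_
    rw [← Nat.sub_add_cancel hN, pow_add, Module.End.mul_apply]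
    exact (isAffineStable_smallSimplices 𝒰).singularSd_pow_mem _ h

lemma admissibleChains_eq (B : Set X) (n : ℕ) : admissibleChains R X B n =
    Finsupp.supported R R {σ : SingularSimplex X n | Admissible B σ} := by
  rw [Finsupp.supported_eq_span_single, admissibleChains]
  congr 1
  ext c
  simp [eq_comm]

lemma chainsIn_eq (B : Set X) (n : ℕ) : chainsIn R X B n =
    Finsupp.supported R R {σ : SingularSimplex X n | Set.range σ ⊆ B} := by
  rw [Finsupp.supported_eq_span_single, chainsIn]
  congr 1
  ext c
  simp [eq_comm]

lemma smallAdmissibleChains_eq (B : Set X) (𝒰 : Set (Set X)) (n : ℕ) :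
    smallAdmissibleChains R X B 𝒰 n =
      admissibleChains R X B n ⊓ Finsupp.supported R R (smallSimplices 𝒰 n) := by
  rw [admissibleChains_eq, ← Finsupp.supported_inter, Finsupp.supported_eq_span_single,
    smallAdmissibleChains]
  congr 1
  ext c
  simp [smallSimplices, eq_comm, and_assoc]

lemma smallChainsIn_eq (B : Set X) (𝒰 : Set (Set X)) (n : ℕ) :
    smallChainsIn R X B 𝒰 n =
      chainsIn R X B n ⊓ Finsupp.supported R R (smallSimplices 𝒰 n) := by
  rw [chainsIn_eq, ← Finsupp.supported_inter, Finsupp.supported_eq_span_single, smallChainsIn]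
  congr 1
  ext c
  simp [smallSimplices, eq_comm, and_assoc]

variable {R}

lemma singularSd_pow_mem_admissibleChains {B : Set X} {n : ℕ} (N : ℕ)
    {c : SingularChain R X n} (hc : c ∈ admissibleChains R X B n) :
    (singularSd R X n ^ N) c ∈ admissibleChains R X B n := by
  rw [admissibleChains_eq] at hc ⊢
  exact (isAffineStable_admissible B).singularSd_pow_mem N hc

lemma singularSd_pow_mem_chainsIn {B : Set X} {n : ℕ} (N : ℕ)
    {c : SingularChain R X n} (hc : c ∈ chainsIn R X B n) :
    (singularSd R X n ^ N) c ∈ chainsIn R X B n := by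
  rw [chainsIn_eq] at hc ⊢
  exact (isAffineStable_range_subset B).singularSd_pow_mem N hc

lemma iteratedHomotopy_mem_admissibleChains {B : Set X} {n : ℕ} (N : ℕ)
    {c : SingularChain R X n} (hc : c ∈ admissibleChains R X B n) :
    iteratedHomotopy R X N n c ∈ admissibleChains R X B (n + 1) := by
  rw [admissibleChains_eq] at hc ⊢
  exact (isAffineStable_admissible B).iteratedHomotopy_mem N hc

lemma iteratedHomotopy_mem_chainsIn {B : Set X} {n : ℕ} (N : ℕ)
    {c : SingularChain R X n} (hc : c ∈ chainsIn R X B n) :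
    iteratedHomotopy R X N n c ∈ chainsIn R X B (n + 1) := by
  rw [chainsIn_eq] at hc ⊢
  exact (isAffineStable_range_subset B).iteratedHomotopy_mem N hc

lemma sub_singularSd_pow_mem_markedBoundaries {B : Set X} {n : ℕ} (N : ℕ)
    {z : SingularChain R X n} (hz : z ∈ markedCycles R X B n) :
    z - (singularSd R X n ^ N) z ∈ markedBoundaries R X B n := by
  cases n with
  | zero =>
    rw [← boundary_iteratedHomotopy_zero]
    exact Submodule.mem_sup_left ⟨_, iteratedHomotopy_mem_admissibleChains N hz, rfl⟩
  | succ n =>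
    rw [← sub_add_cancel (z - _) (iteratedHomotopy R X N n (boundary R X n z)),
      ← boundary_iteratedHomotopy_succ]
    exact Submodule.add_mem_sup ⟨_, iteratedHomotopy_mem_admissibleChains N hz.1, rfl⟩
      (iteratedHomotopy_mem_chainsIn N hz.2)

lemma sub_singularSd_pow_mem_smallMarkedBoundaries {B : Set X} {𝒰 : Set (Set X)} {n : ℕ} (N : ℕ)
    {c : SingularChain R X n} (hc : c ∈ smallMarkedCycles R X B 𝒰 n) :
    c - (singularSd R X n ^ N) c ∈ smallMarkedBoundaries R X B 𝒰 n := by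
  have hsmall := isAffineStable_smallSimplices 𝒰
  cases n with
  | zero =>
    rw [← boundary_iteratedHomotopy_zero]
    rw [smallMarkedCycles, smallAdmissibleChains_eq] at hc
    refine Submodule.mem_sup_left ⟨_, ?_, rfl⟩
    rw [smallAdmissibleChains_eq]
    exact ⟨iteratedHomotopy_mem_admissibleChains N hc.1, hsmall.iteratedHomotopy_mem N hc.2⟩
  | succ n =>
    rw [← sub_add_cancel (c - _) (iteratedHomotopy R X N n (boundary R X n c)),
      ← boundary_iteratedHomotopy_succ]
    rw [smallMarkedCycles, smallAdmissibleChains_eq] at hc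
    refine Submodule.add_mem_sup ⟨_, ?_, rfl⟩ ?_
    · rw [smallAdmissibleChains_eq]
      exact ⟨iteratedHomotopy_mem_admissibleChains N hc.1.1,
        hsmall.iteratedHomotopy_mem N hc.1.2⟩
    · rw [smallChainsIn_eq]
      exact ⟨iteratedHomotopy_mem_chainsIn N hc.2,
        hsmall.iteratedHomotopy_mem N (hsmall.boundary_mem hc.1.2)⟩

end Small

/-- If the interiors of the elements of `𝒰` cover `X`, then the inclusion of `𝒰`-small
marked chains into marked chains induces an isomorphism in homology in every degree:
it is injective and surjective on homology. -/
theorem small_marked_homology_iso {X : Type*} [TopologicalSpace X] {B : Set X}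
    (hXB : IsMarkedSpace X B) (𝒰 : Set (Set X))
    (hcover : (⋃ U ∈ 𝒰, interior U) = Set.univ) (R : Type*) [Ring R] (n : ℕ) :
    (∀ c ∈ smallMarkedCycles R X B 𝒰 n, c ∈ markedBoundaries R X B n →
        c ∈ smallMarkedBoundaries R X B 𝒰 n) ∧
    (∀ z ∈ markedCycles R X B n, ∃ c ∈ smallMarkedCycles R X B 𝒰 n,
        z - c ∈ markedBoundaries R X B n) := by
  constructor
  · intro c hc hcb
    obtain ⟨_, ⟨e, he, rfl⟩, b, hb, rfl⟩ := Submodule.mem_sup.1 hcb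
    obtain ⟨N₀, hN₀⟩ := exists_singularSd_pow_mem R hcover e
    obtain ⟨N₁, hN₁⟩ := exists_singularSd_pow_mem R hcover b
    have h := sub_singularSd_pow_mem_smallMarkedBoundaries (max N₀ N₁) hc
    rw [← sub_add_cancel (boundary R X n e + b) ((singularSd R X n ^ max N₀ N₁) _)]
    refine Submodule.add_mem _ h ?_
    rw [map_add, ← boundary_singularSd_pow]
    refine Submodule.add_mem_sup ⟨_, ?_, rfl⟩ ?_
    · rw [smallAdmissibleChains_eq]
      exact ⟨singularSd_pow_mem_admissibleChains _ he, hN₀ _ (le_max_left _ _)⟩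
    · rw [smallChainsIn_eq]
      exact ⟨singularSd_pow_mem_chainsIn _ hb, hN₁ _ (le_max_right _ _)⟩
  · intro z hz
    obtain ⟨N, hN⟩ := exists_singularSd_pow_mem R hcover z
    refine ⟨_, ?_, sub_singularSd_pow_mem_markedBoundaries N hz⟩
    cases n with
    | zero =>
      rw [smallMarkedCycles, smallAdmissibleChains_eq]
      exact ⟨singularSd_pow_mem_admissibleChains _ hz, hN _ le_rfl⟩
    | succ n =>
      rw [smallMarkedCycles, smallAdmissibleChains_eq]
      refine ⟨⟨singularSd_pow_mem_admissibleChains _ hz.1, hN _ le_rfl⟩, ?_⟩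
      rw [SetLike.mem_coe, Submodule.mem_comap, boundary_singularSd_pow]
      exact singularSd_pow_mem_chainsIn _ hz.2
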